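/- arXiv:2306.13633 — 10 statements merged into one kernel-verified Lean document; each statement's English description precedes it below -/
import Mathlib

section
/- Let p₁, p₂ ∈ (0,1) with p₁ + p₂ = 1 and Σ₁, Σ₂ > 0. Then the function ρ : ℝ → ℝ defined by ρ(α) = (1/2)((1−p₂α)Σ₁ + (1−p₁α)Σ₂) + (1/2)·√(((1−p₂α)Σ₁ + (1−p₁α)Σ₂)² − 4(1−α)Σ₁Σ₂) is nonincreasing on [0, ∞) (it is the leading eigenvalue of the next-generation matrix as a function of the contact parameter α). -/
/-- For `p₁, p₂ ∈ (0,1)` with `p₁ + p₂ = 1` and susceptibilities `S₁, S₂ > 0`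
(denoted Σ₁, Σ₂ in the paper), the leading eigenvalue
`ρ(α) = ½((1−p₂α)Σ₁ + (1−p₁α)Σ₂) + ½ √(((1−p₂α)Σ₁ + (1−p₁α)Σ₂)² − 4(1−α)Σ₁Σ₂)`
of the two-group next-generation matrix is nonincreasing on `[0, ∞)`. -/
theorem rho_antitoneOn (p₁ p₂ S₁ S₂ : ℝ)
    (hp₁ : p₁ ∈ Set.Ioo (0:ℝ) 1) (hp₂ : p₂ ∈ Set.Ioo (0:ℝ) 1)
    (hsum : p₁ + p₂ = 1) (hS₁ : 0 < S₁) (hS₂ : 0 < S₂) :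
    AntitoneOn (fun α : ℝ =>
      (1/2) * ((1 - p₂*α)*S₁ + (1 - p₁*α)*S₂)
        + (1/2) * Real.sqrt (((1 - p₂*α)*S₁ + (1 - p₁*α)*S₂)^2 - 4*(1-α)*S₁*S₂))
      (Set.Ici (0:ℝ)) := by
  obtain ⟨h1, -⟩ := hp₁
  obtain ⟨h2, -⟩ := hp₂
  have e : p₂ = 1 - p₁ := by linarith
  intro a _ b _ hab
  simp only
  obtain ⟨c, hc⟩ : ∃ c, c = p₂ * S₁ + p₁ * S₂ := ⟨_, rfl⟩
  have hc0 : 0 < c := by rw [hc]; positivity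
  have hD : 0 ≤ ((1 - p₂*a)*S₁ + (1 - p₁*a)*S₂)^2 - 4*(1-a)*S₁*S₂ := by
    have h : ((1 - p₂*a)*S₁ + (1 - p₁*a)*S₂)^2 - 4*(1-a)*S₁*S₂
        = ((1 - p₂*a)*S₁ - (1 - p₁*a)*S₂)^2 + 4*a^2*p₁*p₂*S₁*S₂ := by
      subst e; ring
    rw [h]; positivity
  have hs := Real.sqrt_nonneg (((1 - p₂*a)*S₁ + (1 - p₁*a)*S₂)^2 - 4*(1-a)*S₁*S₂)
  have hss := Real.sq_sqrt hD
  set s := Real.sqrt (((1 - p₂*a)*S₁ + (1 - p₁*a)*S₂)^2 - 4*(1-a)*S₁*S₂) with hsdef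
  have key : c^2*a - (c*(S₁+S₂) - 2*S₁*S₂) ≤ c*s := by
    refine abs_le_of_sq_le_sq' ?_ (by positivity) |>.2
    have h : (c*s)^2 - (c^2*a - (c*(S₁+S₂) - 2*S₁*S₂))^2
        = 4*S₁*S₂*p₁*p₂*(S₁-S₂)^2 := by
      rw [mul_pow, hss, hc, e]; ring
    have : 0 ≤ 4*S₁*S₂*p₁*p₂*(S₁-S₂)^2 := by positivity
    linarith
  have hb : Real.sqrt (((1 - p₂*b)*S₁ + (1 - p₁*b)*S₂)^2 - 4*(1-b)*S₁*S₂)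
      ≤ s + c*(b-a) := by
    have hba : 0 ≤ b - a := by linarith
    apply Real.sqrt_le_iff.mpr ⟨by positivity, ?_⟩
    have h : (s + c*(b-a))^2 - (((1 - p₂*b)*S₁ + (1 - p₁*b)*S₂)^2 - 4*(1-b)*S₁*S₂)
        = 2*(b-a)*(c*s - (c^2*a - (c*(S₁+S₂) - 2*S₁*S₂))) := by
      have : (s + c*(b-a))^2 = s^2 + 2*s*c*(b-a) + c^2*(b-a)^2 := by ring
      rw [this, hss, hc]; ring
    have := mul_nonneg hba (sub_nonneg.mpr key)
    linarith
  rw [hc] at hb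
  linarith
end

section
/- Let p₁, p₂ ∈ (0,1) with p₁ + p₂ = 1 and Σ₁, Σ₂ > 0. Then the function ρ : ℝ → ℝ defined by ρ(α) = (1/2)((1−p₂α)Σ₁ + (1−p₁α)Σ₂) + (1/2)·√(((1−p₂α)Σ₁ + (1−p₁α)Σ₂)² − 4(1−α)Σ₁Σ₂) is convex on [0, ∞). -/
/-- For `p₁, p₂ ∈ (0,1)` with `p₁ + p₂ = 1` and susceptibilities `S₁, S₂ > 0`
(denoted Σ₁, Σ₂ in the paper), the leading eigenvalue
`ρ(α) = ½((1−p₂α)Σ₁ + (1−p₁α)Σ₂) + ½ √(((1−p₂α)Σ₁ + (1−p₁α)Σ₂)² − 4(1−α)Σ₁Σ₂)`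
of the two-group next-generation matrix is convex on `[0, ∞)`. -/
theorem rho_convexOn (p₁ p₂ S₁ S₂ : ℝ)
    (hp₁ : p₁ ∈ Set.Ioo (0:ℝ) 1) (hp₂ : p₂ ∈ Set.Ioo (0:ℝ) 1)
    (hsum : p₁ + p₂ = 1) (hS₁ : 0 < S₁) (hS₂ : 0 < S₂) :
    ConvexOn ℝ (Set.Ici (0:ℝ)) (fun α : ℝ =>
      (1/2) * ((1 - p₂*α)*S₁ + (1 - p₁*α)*S₂)
        + (1/2) * Real.sqrt (((1 - p₂*α)*S₁ + (1 - p₁*α)*S₂)^2 - 4*(1-α)*S₁*S₂)) := by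
  obtain ⟨hp₁0, -⟩ := hp₁
  obtain ⟨hp₂0, -⟩ := hp₂
  set c : ℝ := 2 * Real.sqrt (p₁ * p₂ * S₁ * S₂) with hc
  have hc2 : c * c = 4 * (p₁ * p₂ * S₁ * S₂) := by
    have h := Real.mul_self_sqrt (show 0 ≤ p₁ * p₂ * S₁ * S₂ by positivity)
    rw [hc]
    linear_combination 4 * h
  have key : ∀ α : ℝ,
      Real.sqrt (((1 - p₂*α)*S₁ + (1 - p₁*α)*S₂)^2 - 4*(1-α)*S₁*S₂)
        = ‖(⟨(1 - p₂*α)*S₁ - (1 - p₁*α)*S₂, c * α⟩ : ℂ)‖ := by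
    intro α
    rw [Complex.norm_def, Complex.normSq_apply]
    congr 1
    have h2 : p₂ = 1 - p₁ := by linarith
    subst h2
    linear_combination (-α^2) * hc2
  refine ⟨convex_Ici 0, ?_⟩
  intro x _ y _ a b ha hb hab
  simp only [key, smul_eq_mul]
  have tri := norm_add_le
    ((a : ℂ) * (⟨(1 - p₂*x)*S₁ - (1 - p₁*x)*S₂, c * x⟩ : ℂ))
    ((b : ℂ) * (⟨(1 - p₂*y)*S₁ - (1 - p₁*y)*S₂, c * y⟩ : ℂ))
  rw [norm_mul, norm_mul, Complex.norm_of_nonneg ha, Complex.norm_of_nonneg hb] at tri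
  have e : (a : ℂ) * (⟨(1 - p₂*x)*S₁ - (1 - p₁*x)*S₂, c * x⟩ : ℂ)
      + (b : ℂ) * (⟨(1 - p₂*y)*S₁ - (1 - p₁*y)*S₂, c * y⟩ : ℂ)
      = ⟨(1 - p₂*(a*x+b*y))*S₁ - (1 - p₁*(a*x+b*y))*S₂, c * (a*x+b*y)⟩ := by
    apply Complex.ext
    · simp
      linear_combination (S₁ - S₂) * hab
    · simp
      ring
  rw [e] at tri
  have lin : (1 - p₂*(a*x+b*y))*S₁ + (1 - p₁*(a*x+b*y))*S₂
      = a * ((1 - p₂*x)*S₁ + (1 - p₁*x)*S₂) + b * ((1 - p₂*y)*S₁ + (1 - p₁*y)*S₂) := by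
    linear_combination (-(S₁ + S₂)) * hab
  rw [lin]
  linarith
end

section
/- Let (Ω, 𝒫) be a probability space, T : Ω → [0,∞) an integrable random variable with E[T] > 0, and φ : [0,∞) → ℝ a convex function such that φ(T), φ(T/(1+βp₂)) and φ(T/(1−βp₁)) are integrable. Let p₁, p₂ ∈ (0,1) with p₁ + p₂ = 1 and let β ∈ (−1/p₂, 1/p₁). Setting T₁(β) = T/(1+βp₂) and T₂(β) = T/(1−βp₁), and Σᵢ(β) = E[φ(Tᵢ(β))]/E[Tᵢ(β)] for i = 1, 2, one has p₁·Σ₁(β) + p₂·Σ₂(β) ≥ E[φ(T)]/E[T]. -/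
open MeasureTheory

/-- Jensen-type inequality for the two-group vaccine allocation. With
`T₁(β) = T/(1+βp₂)`, `T₂(β) = T/(1−βp₁)` and `Σᵢ(β) = E[φ(Tᵢ(β))]/E[Tᵢ(β)]`, for a convex `φ`
on `[0,∞)` one has `p₁·Σ₁(β) + p₂·Σ₂(β) ≥ E[φ(T)]/E[T]`. -/
theorem fair_allocation_jensen {Ω : Type*} [MeasurableSpace Ω]
    (μ : Measure Ω) [IsProbabilityMeasure μ]
    (T : Ω → ℝ) (hT0 : ∀ ω, 0 ≤ T ω) (hTint : Integrable T μ)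
    (hTmean : 0 < ∫ ω, T ω ∂μ)
    (φ : ℝ → ℝ) (hφ : ConvexOn ℝ (Set.Ici (0:ℝ)) φ)
    (p₁ p₂ β : ℝ)
    (hp₁ : p₁ ∈ Set.Ioo (0:ℝ) 1) (hp₂ : p₂ ∈ Set.Ioo (0:ℝ) 1) (hsum : p₁ + p₂ = 1)
    (hβ : β ∈ Set.Ioo (-(1/p₂)) (1/p₁))
    (hintT : Integrable (fun ω => φ (T ω)) μ)
    (hint1 : Integrable (fun ω => φ (T ω / (1 + β*p₂))) μ)
    (hint2 : Integrable (fun ω => φ (T ω / (1 - β*p₁))) μ) :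
    p₁ * ((∫ ω, φ (T ω / (1 + β*p₂)) ∂μ) / (∫ ω, T ω / (1 + β*p₂) ∂μ))
      + p₂ * ((∫ ω, φ (T ω / (1 - β*p₁)) ∂μ) / (∫ ω, T ω / (1 - β*p₁) ∂μ))
    ≥ (∫ ω, φ (T ω) ∂μ) / (∫ ω, T ω ∂μ) := by
  have ha : 0 < 1 + β * p₂ := by
    have h := hβ.1
    have h2 := mul_lt_mul_of_pos_right h hp₂.1
    have h3 : -(1 / p₂) * p₂ = -1 := by
      have := hp₂.1.ne'
      field_simp
    linarith
  have hb : 0 < 1 - β * p₁ := by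
    have h2 := (lt_div_iff₀ hp₁.1).1 hβ.2
    linarith
  have hw : p₁ * (1 + β * p₂) + p₂ * (1 - β * p₁) = 1 := by linear_combination hsum
  generalize 1 + β * p₂ = a at *
  generalize 1 - β * p₁ = b at *
  have key : ∀ ω, φ (T ω) ≤ (p₁ * a) * φ (T ω / a) + (p₂ * b) * φ (T ω / b) := by
    intro ω
    have h := hφ.2 (x := T ω / a) (y := T ω / b) (div_nonneg (hT0 ω) ha.le)
      (div_nonneg (hT0 ω) hb.le) (mul_pos hp₁.1 ha).le (mul_pos hp₂.1 hb).le hw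
    have e : (p₁ * a) • (T ω / a) + (p₂ * b) • (T ω / b) = T ω := by
      simp only [smul_eq_mul]
      field_simp
      linear_combination T ω * hsum
    rw [e] at h
    simpa only [smul_eq_mul] using h
  have hI := integral_mono hintT ((hint1.const_mul (p₁ * a)).add (hint2.const_mul (p₂ * b))) key
  simp only [Pi.add_apply] at hI
  rw [integral_add (hint1.const_mul (p₁ * a)) (hint2.const_mul (p₂ * b)),
    integral_const_mul, integral_const_mul] at hI
  rw [integral_div, integral_div, ge_iff_le, div_le_iff₀ hTmean]
  refine hI.trans (le_of_eq ?_)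
  have := hTmean.ne'
  field_simp
end

section
/- Let (Ω, 𝒫) be a probability space, T : Ω → [0,∞) an integrable random variable with E[T] > 0, and s : [0,∞) → [0,1] a nondecreasing measurable function; set φ(t) = ∫₀ᵗ s(u) du. Let p₁, p₂ ∈ (0,1) with p₁ + p₂ = 1 and β ∈ (−1/p₂, 1/p₁). Define T₁(β) = T/(1+βp₂), T₂(β) = T/(1−βp₁), Σᵢ(β) = E[φ(Tᵢ(β))]/E[Tᵢ(β)], and for α ∈ ℝ let ρ(α, β) = (1/2)((1−p₂α)Σ₁(β) + (1−p₁α)Σ₂(β)) + (1/2)·√(((1−p₂α)Σ₁(β) + (1−p₁α)Σ₂(β))² − 4(1−α)Σ₁(β)Σ₂(β)). Then for every α ∈ [0,1], ρ(α, β) ≥ ρ(α, 0); equivalently, the endemic threshold R_c(β) = 1/ρ(α, β) is maximal at β = 0 (fair allocation of vaccine doses is optimal for preventing endemicity in an assortative population). -/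
open MeasureTheory

/-- Mean susceptibility of group 1 at the disease-free equilibrium when group 1 is vaccinated
at intervals `T₁(β) = T/(1+βp₂)`: `Σ₁(β) = E[φ(T₁(β))]/E[T₁(β)]` with `φ(t) = ∫₀ᵗ s(u) du`. -/
noncomputable def meanSusc1 {Ω : Type*} [MeasurableSpace Ω] (μ : Measure Ω)
    (T : Ω → ℝ) (s : ℝ → ℝ) (p₂ β : ℝ) : ℝ :=
  (∫ ω, (∫ u in (0:ℝ)..(T ω / (1 + β*p₂)), s u) ∂μ) / (∫ ω, T ω / (1 + β*p₂) ∂μ)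

/-- Mean susceptibility of group 2 at the disease-free equilibrium when group 2 is vaccinated
at intervals `T₂(β) = T/(1−βp₁)`: `Σ₂(β) = E[φ(T₂(β))]/E[T₂(β)]` with `φ(t) = ∫₀ᵗ s(u) du`. -/
noncomputable def meanSusc2 {Ω : Type*} [MeasurableSpace Ω] (μ : Measure Ω)
    (T : Ω → ℝ) (s : ℝ → ℝ) (p₁ β : ℝ) : ℝ :=
  (∫ ω, (∫ u in (0:ℝ)..(T ω / (1 - β*p₁)), s u) ∂μ) / (∫ ω, T ω / (1 - β*p₁) ∂μ)

/-- Leading eigenvalue of the two-group next-generation matrix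
`M = [[(1−p₂α)Σ₁, p₂αΣ₂], [p₁αΣ₁, (1−p₁α)Σ₂]]`. -/
noncomputable def leadEV (p₁ p₂ S₁ S₂ α : ℝ) : ℝ :=
  (1/2) * ((1 - p₂*α)*S₁ + (1 - p₁*α)*S₂)
    + (1/2) * Real.sqrt (((1 - p₂*α)*S₁ + (1 - p₁*α)*S₂)^2 - 4*(1-α)*S₁*S₂)


lemma phi_integrable {Ω : Type*} [MeasurableSpace Ω]
    (μ : Measure Ω) 
    (T : Ω → ℝ) (hT0 : ∀ ω, 0 ≤ T ω) (hTint : Integrable T μ)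
    (s : ℝ → ℝ) (hmono : MonotoneOn s (Set.Ici (0:ℝ)))
    (hrange : ∀ a, 0 ≤ a → s a ∈ Set.Icc (0:ℝ) 1) (x : ℝ) (hx : 0 < x) :
    Integrable (fun ω => ∫ u in (0:ℝ)..(T ω / x), s u) μ := by
  have hm : Monotone (fun u => s (max u 0)) := fun u v h =>
    hmono (le_max_right u 0) (le_max_right v 0) (max_le_max_right 0 h)
  have hc : Continuous (fun t => ∫ u in (0:ℝ)..t, s (max u 0)) :=
    intervalIntegral.continuous_primitive (fun a b => hm.intervalIntegrable) 0
  have he : (fun ω => ∫ u in (0:ℝ)..(T ω / x), s u)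
      = fun ω => ∫ u in (0:ℝ)..(T ω / x), s (max u 0) := by
    funext ω
    have h0 : 0 ≤ T ω / x := div_nonneg (hT0 ω) hx.le
    apply intervalIntegral.integral_congr
    intro u hu
    rw [Set.uIcc_of_le h0] at hu
    simp [max_eq_left hu.1]
  rw [he]
  have hTx : Integrable (fun ω => T ω / x) μ := hTint.div_const x
  refine hTx.mono (hc.comp_aestronglyMeasurable hTx.aestronglyMeasurable) ?_
  refine Filter.Eventually.of_forall fun ω => ?_
  have := intervalIntegral.norm_integral_le_of_norm_le_const (a := 0) (b := T ω / x) (C := 1)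
    (f := fun u => s (max u 0)) (fun u _ => by
      have := hrange (max u 0) (le_max_right _ _)
      rw [Real.norm_eq_abs, abs_le]
      constructor <;> linarith [this.1, this.2])
  simpa [abs_div] using this

lemma phi_subgrad (s : ℝ → ℝ) (hmono : MonotoneOn s (Set.Ici (0:ℝ)))
    (t y : ℝ) (ht : 0 ≤ t) (hy : 0 ≤ y) :
    s t * (y - t) ≤ (∫ u in (0:ℝ)..y, s u) - ∫ u in (0:ℝ)..t, s u := by
  have hi : ∀ a b : ℝ, 0 ≤ a → 0 ≤ b → IntervalIntegrable s volume a b := fun a b ha hb =>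
    (hmono.mono (fun u hu => le_trans (le_min ha hb) hu.1)).intervalIntegrable
  rw [intervalIntegral.integral_interval_sub_left (hi 0 y le_rfl hy) (hi 0 t le_rfl ht)]
  rcases le_total t y with h | h
  · have := intervalIntegral.integral_mono_on (f := fun _ => s t) h
      intervalIntegrable_const (hi t y ht hy)
      (fun u hu => hmono ht (Set.mem_Ici.2 (ht.trans hu.1)) hu.1)
    simp only [intervalIntegral.integral_const, smul_eq_mul] at this
    linarith
  · have := intervalIntegral.integral_mono_on (g := fun _ => s t) h
      (hi y t hy ht) intervalIntegrable_const
      (fun u hu => hmono (Set.mem_Ici.2 (hy.trans hu.1)) ht hu.2)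
    simp only [intervalIntegral.integral_const, smul_eq_mul] at this
    rw [intervalIntegral.integral_symm]
    linarith

lemma leadEV_ge (p₁ p₂ S₁ S₂ α : ℝ) (hp₁ : 0 < p₁) (hp₂ : 0 < p₂) (hsum : p₁ + p₂ = 1)
    (hα : α ≤ 1) : p₁ * S₁ + p₂ * S₂ ≤ leadEV p₁ p₂ S₁ S₂ α := by
  obtain rfl : p₂ = 1 - p₁ := by linarith
  unfold leadEV
  have key : 0 ≤ (1 - α) * (p₁ * (1 - p₁) * (S₁ - S₂)^2) :=
    mul_nonneg (by linarith) (mul_nonneg (mul_nonneg hp₁.le hp₂.le) (sq_nonneg _))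
  have := Real.le_sqrt_of_sq_le (x := 2 * (p₁ * S₁ + (1 - p₁) * S₂)
      - ((1 - (1 - p₁)*α)*S₁ + (1 - p₁*α)*S₂))
    (y := ((1 - (1 - p₁)*α)*S₁ + (1 - p₁*α)*S₂)^2 - 4*(1-α)*S₁*S₂) (by linear_combination 4 * key)
  linarith

lemma leadEV_diag (p₁ p₂ S α : ℝ) (hsum : p₁ + p₂ = 1)
    (hα : 0 ≤ α) (hS : 0 ≤ S) : leadEV p₁ p₂ S S α = S := by
  obtain rfl : p₂ = 1 - p₁ := by linarith
  unfold leadEV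
  have : ((1 - (1 - p₁)*α)*S + (1 - p₁*α)*S)^2 - 4*(1-α)*S*S = (α * S)^2 := by ring
  rw [this, Real.sqrt_sq (mul_nonneg hα hS)]
  ring

/-- In an assortative population (`α ∈ [0,1]`), for any fairness parameter
`β ∈ (−1/p₂, 1/p₁)` one has `ρ(α, β) ≥ ρ(α, 0)`: the fair allocation `β = 0` of vaccine doses
minimizes the leading eigenvalue of the next-generation matrix, i.e. maximizes the endemic
threshold `R_c(β) = 1/ρ(α,β)`. -/
theorem fair_allocation_optimal {Ω : Type*} [MeasurableSpace Ω]
    (μ : Measure Ω) [IsProbabilityMeasure μ]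
    (T : Ω → ℝ) (hT0 : ∀ ω, 0 ≤ T ω) (hTint : Integrable T μ)
    (hTmean : 0 < ∫ ω, T ω ∂μ)
    (s : ℝ → ℝ) (hs : Measurable s) (hmono : MonotoneOn s (Set.Ici (0:ℝ)))
    (hrange : ∀ a, 0 ≤ a → s a ∈ Set.Icc (0:ℝ) 1)
    (p₁ p₂ β : ℝ)
    (hp₁ : p₁ ∈ Set.Ioo (0:ℝ) 1) (hp₂ : p₂ ∈ Set.Ioo (0:ℝ) 1) (hsum : p₁ + p₂ = 1)
    (hβ : β ∈ Set.Ioo (-(1/p₂)) (1/p₁)) :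
    ∀ α ∈ Set.Icc (0:ℝ) 1,
      leadEV p₁ p₂ (meanSusc1 μ T s p₂ β) (meanSusc2 μ T s p₁ β) α
        ≥ leadEV p₁ p₂ (meanSusc1 μ T s p₂ 0) (meanSusc2 μ T s p₁ 0) α := by
  intro α hα
  obtain ⟨hp1, hp1'⟩ := hp₁
  obtain ⟨hp2, hp2'⟩ := hp₂
  have ha : 0 < 1 + β * p₂ := by
    have h := mul_lt_mul_of_pos_right hβ.1 hp2
    have : -(1/p₂) * p₂ = -1 := by field_simp
    linarith
  have hb : 0 < 1 - β * p₁ := by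
    have h := mul_lt_mul_of_pos_right hβ.2 hp1
    have : 1/p₁ * p₁ = 1 := by field_simp
    linarith
  have h10 : meanSusc1 μ T s p₂ 0 = (∫ ω, (∫ u in (0:ℝ)..(T ω), s u) ∂μ) / ∫ ω, T ω ∂μ := by
    simp [meanSusc1]
  have h20 : meanSusc2 μ T s p₁ 0 = (∫ ω, (∫ u in (0:ℝ)..(T ω), s u) ∂μ) / ∫ ω, T ω ∂μ := by
    simp [meanSusc2]
  have hS : 0 ≤ (∫ ω, (∫ u in (0:ℝ)..(T ω), s u) ∂μ) / ∫ ω, T ω ∂μ :=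
    div_nonneg (integral_nonneg fun ω => intervalIntegral.integral_nonneg (hT0 ω)
      fun u hu => (hrange u hu.1).1) hTmean.le
  rw [h10, h20, leadEV_diag p₁ p₂ _ α hsum hα.1 hS]
  refine le_trans ?_ (leadEV_ge p₁ p₂ _ _ α hp1 hp2 hsum hα.2)
  have i1 := phi_integrable μ T hT0 hTint s hmono hrange _ ha
  have i2 := phi_integrable μ T hT0 hTint s hmono hrange _ hb
  have i0 := phi_integrable μ T hT0 hTint s hmono hrange 1 one_pos
  simp only [div_one] at i0
  have e1 : meanSusc1 μ T s p₂ β = (1 + β * p₂) *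
      (∫ ω, (∫ u in (0:ℝ)..(T ω / (1 + β*p₂)), s u) ∂μ) / ∫ ω, T ω ∂μ := by
    unfold meanSusc1
    rw [integral_div]
    field_simp
  have e2 : meanSusc2 μ T s p₁ β = (1 - β * p₁) *
      (∫ ω, (∫ u in (0:ℝ)..(T ω / (1 - β*p₁)), s u) ∂μ) / ∫ ω, T ω ∂μ := by
    unfold meanSusc2
    rw [integral_div]
    field_simp
  rw [e1, e2, ← mul_div_assoc, ← mul_div_assoc, ← add_div]
  refine div_le_div_of_nonneg_right ?_ hTmean.le
  rw [← mul_assoc, ← mul_assoc, ← integral_const_mul, ← integral_const_mul,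
    ← integral_add (i1.const_mul _) (i2.const_mul _)]
  refine integral_mono i0 ((i1.const_mul _).add (i2.const_mul _)) fun ω => ?_
  have g1 := phi_subgrad s hmono (T ω) (T ω / (1 + β*p₂)) (hT0 ω) (div_nonneg (hT0 ω) ha.le)
  have g2 := phi_subgrad s hmono (T ω) (T ω / (1 - β*p₁)) (hT0 ω) (div_nonneg (hT0 ω) hb.le)
  have g1' := mul_le_mul_of_nonneg_left g1 (mul_pos hp1 ha).le
  have g2' := mul_le_mul_of_nonneg_left g2 (mul_pos hp2 hb).le
  have q1 : (1 + β*p₂) * (T ω / (1 + β*p₂)) = T ω := by field_simp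
  have q2 : (1 - β*p₁) * (T ω / (1 - β*p₁)) = T ω := by field_simp
  have z : p₁ * (1 + β*p₂) * (s (T ω) * (T ω / (1 + β*p₂) - T ω))
      + p₂ * (1 - β*p₁) * (s (T ω) * (T ω / (1 - β*p₁) - T ω)) = 0 := by
    linear_combination p₁ * s (T ω) * q1 + p₂ * s (T ω) * q2
  have w : p₁ * (1 + β*p₂) + p₂ * (1 - β*p₁) = 1 := by linear_combination hsum
  have w' : (p₁ * (1 + β*p₂) + p₂ * (1 - β*p₁)) * (∫ u in (0:ℝ)..(T ω), s u)
    = ∫ u in (0:ℝ)..(T ω), s u := by rw [w, one_mul]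
  dsimp only
  linarith
end

section
/- Let (Ω, 𝒫) be a probability space and T : Ω → [0,∞) an integrable random variable. Let s : [0,∞) → [0,1] be a nondecreasing measurable function and define Φ(t) = ∫₀ᵗ s(u) du. Then E[Φ(T)] ≥ Φ(E[T]). Consequently, among all distributions of the time between vaccine doses with fixed mean m = E[T], the mean stationary susceptibility Σ = E[Φ(T)]/E[T] is minimized by the deterministic (evenly spaced) strategy T = m, for which Σ = Φ(m)/m. -/
open MeasureTheory

/-- For a nonnegative integrable inter-vaccination time `T` and the convex function
`Φ(t) = ∫₀ᵗ s(u) du` built from a nondecreasing susceptibility `s : [0,∞) → [0,1]`, Jensen's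
inequality gives `E[Φ(T)] ≥ Φ(E[T])`; consequently the mean stationary susceptibility
`Σ = E[Φ(T)]/E[T]` is at least `Φ(m)/m` for `m = E[T]`, i.e. it is minimized by the
deterministic (evenly spaced) strategy `T = m`. -/
theorem evenly_spaced_optimal {Ω : Type*} [MeasurableSpace Ω]
    (μ : Measure Ω) [IsProbabilityMeasure μ]
    (T : Ω → ℝ) (hT0 : ∀ ω, 0 ≤ T ω) (hTint : Integrable T μ)
    (s : ℝ → ℝ) (hs : Measurable s) (hmono : MonotoneOn s (Set.Ici (0:ℝ)))
    (hrange : ∀ a, 0 ≤ a → s a ∈ Set.Icc (0:ℝ) 1) :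
    (∫ ω, (∫ u in (0:ℝ)..(T ω), s u) ∂μ) ≥ ∫ u in (0:ℝ)..(∫ ω, T ω ∂μ), s u
    ∧ (∫ ω, (∫ u in (0:ℝ)..(T ω), s u) ∂μ) / (∫ ω, T ω ∂μ)
        ≥ (∫ u in (0:ℝ)..(∫ ω, T ω ∂μ), s u) / (∫ ω, T ω ∂μ) := by
  have hII : ∀ a b : ℝ, 0 ≤ a → 0 ≤ b → IntervalIntegrable s volume a b := by
    intro a b ha hb
    apply MonotoneOn.intervalIntegrable
    apply hmono.mono
    intro x hx
    exact le_trans (le_min ha hb) hx.1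
  -- supporting line inequality
  have hsup : ∀ m t : ℝ, 0 ≤ m → 0 ≤ t →
      (∫ u in (0:ℝ)..m, s u) + s m * (t - m) ≤ ∫ u in (0:ℝ)..t, s u := by
    intro m t hm ht
    rw [← intervalIntegral.integral_add_adjacent_intervals (hII 0 m le_rfl hm) (hII m t hm ht)]
    have hc : ∀ a b : ℝ, (∫ _u in a..b, s m) = s m * (b - a) := by
      intro a b
      rw [intervalIntegral.integral_const, smul_eq_mul, mul_comm]
    rcases le_total m t with h | h
    · have := intervalIntegral.integral_mono_on (f := fun _ => s m) (g := s) h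
        intervalIntegrable_const (hII m t hm ht)
        (fun x hx => hmono hm (hm.trans hx.1) hx.1)
      rw [hc] at this
      linarith
    · have := intervalIntegral.integral_mono_on (f := s) (g := fun _ => s m) h
        (hII t m ht hm) intervalIntegrable_const
        (fun x hx => hmono (ht.trans hx.1) hm hx.2)
      rw [hc] at this
      rw [intervalIntegral.integral_symm t m]
      linarith
  have hnn : ∀ t : ℝ, 0 ≤ t → 0 ≤ ∫ u in (0:ℝ)..t, s u := fun t ht =>
    intervalIntegral.integral_nonneg ht (fun u hu => (hrange u hu.1).1)
  have hle : ∀ t : ℝ, 0 ≤ t → (∫ u in (0:ℝ)..t, s u) ≤ t := by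
    intro t ht
    have := intervalIntegral.integral_mono_on (f := s) (g := fun _ => (1:ℝ)) ht
      (hII 0 t le_rfl ht) intervalIntegrable_const (fun x hx => (hrange x hx.1).2)
    simpa using this
  have hmeas : Measurable (fun t : ℝ => ∫ u in (0:ℝ)..(max t 0), s u) := by
    apply Monotone.measurable
    intro a b hab
    have h0 : (0:ℝ) ≤ max a 0 := le_max_right _ _
    have h1 : max a 0 ≤ max b 0 := max_le_max_right 0 hab
    have h2 := hsup (max a 0) (max b 0) h0 (h0.trans h1)
    have h3 := mul_nonneg (hrange _ h0).1 (sub_nonneg.2 h1)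
    show (∫ u in (0:ℝ)..(max a 0), s u) ≤ ∫ u in (0:ℝ)..(max b 0), s u
    linarith
  have hint : Integrable (fun ω => ∫ u in (0:ℝ)..(T ω), s u) μ := by
    have hm : AEStronglyMeasurable (fun ω => ∫ u in (0:ℝ)..(T ω), s u) μ := by
      have := (hmeas.comp_aemeasurable hTint.aemeasurable).aestronglyMeasurable
      refine this.congr (Filter.Eventually.of_forall fun ω => ?_)
      simp [max_eq_left (hT0 ω)]
    refine hTint.mono hm (Filter.Eventually.of_forall fun ω => ?_)
    rw [Real.norm_of_nonneg (hnn _ (hT0 ω)), Real.norm_of_nonneg (hT0 ω)]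
    exact hle _ (hT0 ω)
  have hm0 : 0 ≤ ∫ ω, T ω ∂μ := integral_nonneg hT0
  have main : (∫ u in (0:ℝ)..(∫ ω, T ω ∂μ), s u) ≤ ∫ ω, (∫ u in (0:ℝ)..(T ω), s u) ∂μ := by
    generalize hM : (∫ ω, T ω ∂μ) = m at hm0 ⊢
    have hi : Integrable (fun ω => s m * (T ω - m)) μ :=
      (hTint.sub (integrable_const m)).const_mul _
    have h := integral_mono ((integrable_const (∫ u in (0:ℝ)..m, s u)).add hi) hint
      (fun ω => hsup m (T ω) hm0 (hT0 ω))
    have e : ∫ ω, s m * (T ω - m) ∂μ = 0 := by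
      rw [integral_const_mul, integral_sub hTint (integrable_const m), hM]
      simp
    rw [integral_add' (integrable_const _) hi, e] at h
    simpa using h
  exact ⟨main, div_le_div_of_nonneg_right main hm0⟩
end

section
/- Let (Ω, 𝒫) be a probability space and T : Ω → [0,∞) an integrable random variable with E[T] > 0. Let s : [0,∞) → [0,1] be a nondecreasing measurable function and define Φ(t) = ∫₀ᵗ s(u) du. Then for all real numbers 0 < m₁ ≤ m₂, E[Φ(m₁T)]/(m₁·E[T]) ≤ E[Φ(m₂T)]/(m₂·E[T]); that is, the map m ↦ E[Φ(mT)]/E[mT] is nondecreasing on (0,∞) (vaccinating less often increases the stationary susceptibility of the population). -/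
open MeasureTheory

/-- With `Φ(t) = ∫₀ᵗ s(u) du` for a nondecreasing `s : [0,∞) → [0,1]` and a
nonnegative integrable `T` with `E[T] > 0`, the map `m ↦ E[Φ(mT)]/E[mT]` is nondecreasing on
`(0,∞)`: vaccinating less often increases the stationary susceptibility of the population. -/
theorem susceptibility_mono_in_scale {Ω : Type*} [MeasurableSpace Ω]
    (μ : Measure Ω) [IsProbabilityMeasure μ]
    (T : Ω → ℝ) (hT0 : ∀ ω, 0 ≤ T ω) (hTint : Integrable T μ)
    (hTmean : 0 < ∫ ω, T ω ∂μ)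
    (s : ℝ → ℝ) (hs : Measurable s) (hmono : MonotoneOn s (Set.Ici (0:ℝ)))
    (hrange : ∀ a, 0 ≤ a → s a ∈ Set.Icc (0:ℝ) 1) :
    ∀ m₁ m₂ : ℝ, 0 < m₁ → m₁ ≤ m₂ →
      (∫ ω, (∫ u in (0:ℝ)..(m₁ * T ω), s u) ∂μ) / (m₁ * ∫ ω, T ω ∂μ)
        ≤ (∫ ω, (∫ u in (0:ℝ)..(m₂ * T ω), s u) ∂μ) / (m₂ * ∫ ω, T ω ∂μ) := by
  intro m₁ m₂ h1 h12
  have h2 : 0 < m₂ := lt_of_lt_of_le h1 h12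
  obtain ⟨g, hg⟩ : ∃ g : ℝ → ℝ, g = fun u => s (max u 0) := ⟨_, rfl⟩
  have gmono : Monotone g := by
    intro a b hab
    rw [hg]
    exact hmono (le_max_right a 0) (le_max_right b 0) (max_le_max_right 0 hab)
  have g01 : ∀ u, g u ∈ Set.Icc (0:ℝ) 1 := by
    intro u
    rw [hg]
    exact hrange _ (le_max_right u 0)
  have gint : ∀ a b, IntervalIntegrable g volume a b := fun a b => gmono.intervalIntegrable
  have hphi : ∀ m : ℝ, 0 < m → ∀ ω,
      (∫ u in (0:ℝ)..(m * T ω), s u) = ∫ u in (0:ℝ)..(m * T ω), g u := by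
    intro m hm ω
    apply intervalIntegral.integral_congr
    intro u hu
    rw [Set.uIcc_of_le (mul_nonneg hm.le (hT0 ω))] at hu
    simp [hg, max_eq_left hu.1]
  have hscale : ∀ m : ℝ, ∀ ω,
      (∫ u in (0:ℝ)..(m * T ω), g u) = m * ∫ u in (0:ℝ)..(T ω), g (m * u) := by
    intro m ω
    have := intervalIntegral.smul_integral_comp_mul_left (a := 0) (b := T ω) g m
    rw [mul_zero, smul_eq_mul] at this
    exact this.symm
  have gmi : ∀ m : ℝ, 0 < m → ∀ a b, IntervalIntegrable (fun u => g (m * u)) volume a b := by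
    intro m hm a b
    have : Monotone (fun u => g (m * u)) := fun x y hxy =>
      gmono (mul_le_mul_of_nonneg_left hxy hm.le)
    exact this.intervalIntegrable
  have hI : ∀ m : ℝ, 0 < m → Integrable (fun ω => ∫ u in (0:ℝ)..(T ω), g (m * u)) μ := by
    intro m hm
    have hc : Continuous (fun t => ∫ u in (0:ℝ)..t, g (m * u)) :=
      intervalIntegral.continuous_primitive (gmi m hm) 0
    refine hTint.mono (hc.comp_aestronglyMeasurable hTint.aestronglyMeasurable) ?_
    refine Filter.Eventually.of_forall fun ω => ?_
    have := intervalIntegral.norm_integral_le_of_norm_le_const (a := 0) (b := T ω) (C := 1)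
      (f := fun u => g (m * u)) (fun u _ => by
        rw [Real.norm_eq_abs, abs_of_nonneg (g01 _).1]; exact (g01 _).2)
    simpa using this
  have hE : ∀ m : ℝ, 0 < m →
      (∫ ω, (∫ u in (0:ℝ)..(m * T ω), s u) ∂μ) / (m * ∫ ω, T ω ∂μ)
        = (∫ ω, (∫ u in (0:ℝ)..(T ω), g (m * u)) ∂μ) / ∫ ω, T ω ∂μ := by
    intro m hm
    simp_rw [hphi m hm, hscale m]
    rw [integral_const_mul, mul_div_mul_left _ _ hm.ne']
  rw [hE m₁ h1, hE m₂ h2]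
  refine div_le_div_of_nonneg_right ?_ hTmean.le
  refine integral_mono (hI m₁ h1) (hI m₂ h2) fun ω => ?_
  refine intervalIntegral.integral_mono_on (hT0 ω) (gmi m₁ h1 _ _) (gmi m₂ h2 _ _) fun u hu => ?_
  exact gmono (mul_le_mul_of_nonneg_right h12 hu.1)
end

section
/- Let σ : [0,∞) → [0,1] be a nondecreasing measurable function, φ(a) = ∫₀ᵃ σ(u) du, let g : [0,∞) → [0,∞) be an integrable function with ∫₀^∞ g(a) σ(a) da > 0, and let c ≥ 0. Define, for x > 0, F(x) = c·x + (∫₀^∞ g(a) e^{−xφ(a)} da) / (∫₀^∞ g(a) σ(a) e^{−xφ(a)} da). Then F is nondecreasing on (0,∞), and strictly increasing if c > 0. -/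
open MeasureTheory

/-- The endemic function (deterministic susceptibility case):
`F(x) = c·x + (∫₀^∞ g(a) e^{−xφ(a)} da) / (∫₀^∞ g(a) σ(a) e^{−xφ(a)} da)`
with `φ(a) = ∫₀ᵃ σ(u) du`. -/
noncomputable def endemicFun (sig g : ℝ → ℝ) (c x : ℝ) : ℝ :=
  c * x + (∫ a in Set.Ioi (0:ℝ), g a * Real.exp (-x * ∫ u in (0:ℝ)..a, sig u))
    / (∫ a in Set.Ioi (0:ℝ), g a * sig a * Real.exp (-x * ∫ u in (0:ℝ)..a, sig u))

theorem lin_aux (s : Set ℝ) (p q r t : ℝ → ℝ) (A B C D : ℝ) (hp : IntegrableOn p s)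
    (hq : IntegrableOn q s) (hr : IntegrableOn r s) (ht : IntegrableOn t s) :
    ∫ a in s, (A * p a - B * q a - C * r a + D * t a)
      = A * (∫ a in s, p a) - B * (∫ a in s, q a) - C * (∫ a in s, r a)
        + D * (∫ a in s, t a) := by
  have h1 : IntegrableOn (fun a => A * p a) s := hp.const_mul _
  have h2 : IntegrableOn (fun a => B * q a) s := hq.const_mul _
  have h3 : IntegrableOn (fun a => C * r a) s := hr.const_mul _
  have h4 : IntegrableOn (fun a => D * t a) s := ht.const_mul _
  have h12 : IntegrableOn (fun a => A * p a - B * q a) s := h1.sub h2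
  have h123 : IntegrableOn (fun a => A * p a - B * q a - C * r a) s := h12.sub h3
  rw [integral_add h123 h4, integral_sub h12 h3, integral_sub h1 h2, integral_const_mul,
    integral_const_mul, integral_const_mul, integral_const_mul]

theorem cheb_aux (s : Set ℝ) (hs : MeasurableSet s) (w f h : ℝ → ℝ)
    (hw0 : ∀ a ∈ s, 0 ≤ w a)
    (hw : IntegrableOn w s) (hwf : IntegrableOn (fun a => w a * f a) s)
    (hwh : IntegrableOn (fun a => w a * h a) s)
    (hwfh : IntegrableOn (fun a => w a * f a * h a) s)
    (hopp : ∀ a ∈ s, ∀ b ∈ s, (f a - f b) * (h a - h b) ≤ 0) :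
    (∫ a in s, w a) * (∫ a in s, w a * f a * h a)
      ≤ (∫ a in s, w a * h a) * (∫ a in s, w a * f a) := by
  set W := ∫ a in s, w a with hW
  set S := ∫ a in s, w a * f a with hS
  set H := ∫ a in s, w a * h a with hH
  set P := ∫ a in s, w a * f a * h a with hP
  have h1 : ∀ b ∈ s, P - f b * H - h b * S + f b * h b * W ≤ 0 := by
    intro b hb
    have e : P - f b * H - h b * S + f b * h b * W
        = ∫ a in s, (1 * (w a * f a * h a) - f b * (w a * h a) - h b * (w a * f a)
            + f b * h b * w a) := by
      rw [lin_aux s _ _ _ _ _ _ _ _ hwfh hwh hwf hw, one_mul]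
    rw [e]
    apply setIntegral_nonpos hs
    intro a ha
    have := mul_nonneg (hw0 a ha) (neg_nonneg.2 (hopp a ha b hb))
    nlinarith
  have h2 : ∫ b in s, (P * w b - H * (w b * f b) - S * (w b * h b)
      + W * (w b * f b * h b)) ≤ 0 := by
    apply setIntegral_nonpos hs
    intro b hb
    have := mul_nonneg (hw0 b hb) (neg_nonneg.2 (h1 b hb))
    nlinarith
  rw [lin_aux s _ _ _ _ _ _ _ _ hw hwf hwh hwfh] at h2
  rw [← hW, ← hS, ← hH, ← hP] at h2
  nlinarith

/-- For a nondecreasing `σ : [0,∞) → [0,1]` (written `sig`), an integrable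
nonnegative weight `g` with `∫ g σ > 0`, and `c ≥ 0`, the endemic function `F` is nondecreasing
on `(0,∞)`, and strictly increasing if `c > 0`. -/
theorem endemicFun_mono (sig : ℝ → ℝ) (hsm : Measurable sig)
    (hmono : MonotoneOn sig (Set.Ici (0:ℝ)))
    (hrange : ∀ a, 0 ≤ a → sig a ∈ Set.Icc (0:ℝ) 1)
    (g : ℝ → ℝ) (hg0 : ∀ a, 0 ≤ g a) (hg : IntegrableOn g (Set.Ioi (0:ℝ)))
    (hgs : 0 < ∫ a in Set.Ioi (0:ℝ), g a * sig a)
    (c : ℝ) (hc : 0 ≤ c) :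
    MonotoneOn (endemicFun sig g c) (Set.Ioi (0:ℝ))
    ∧ (0 < c → StrictMonoOn (endemicFun sig g c) (Set.Ioi (0:ℝ))) := by
  obtain ⟨φ, hφ⟩ : ∃ φ : ℝ → ℝ, φ = fun a => ∫ u in (0:ℝ)..a, sig u := ⟨_, rfl⟩
  have hii : ∀ a b, 0 ≤ a → 0 ≤ b → IntervalIntegrable sig volume a b := by
    intro a b ha hb
    apply MonotoneOn.intervalIntegrable
    apply hmono.mono
    intro t ht
    exact (le_min ha hb).trans ht.1
  have hφm : MonotoneOn φ (Set.Ioi (0:ℝ)) := by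
    intro a ha b hb hab
    have ha' : (0:ℝ) ≤ a := le_of_lt ha
    have hb' : (0:ℝ) ≤ b := le_of_lt hb
    have e := intervalIntegral.integral_add_adjacent_intervals (hii 0 a le_rfl ha')
      (hii a b ha' hb')
    have p : 0 ≤ ∫ u in a..b, sig u :=
      intervalIntegral.integral_nonneg hab fun u hu => (hrange u (ha'.trans hu.1)).1
    simp only [hφ]
    linarith
  have hφ0 : ∀ a ∈ Set.Ioi (0:ℝ), 0 ≤ φ a := by
    intro a ha
    simp only [hφ]
    exact intervalIntegral.integral_nonneg (le_of_lt ha) fun u hu => (hrange u hu.1).1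
  have hφae : AEMeasurable φ (volume.restrict (Set.Ioi (0:ℝ))) :=
    aemeasurable_restrict_of_monotoneOn measurableSet_Ioi hφm
  have bdd : ∀ f k : ℝ → ℝ, IntegrableOn f (Set.Ioi (0:ℝ)) →
      AEMeasurable k (volume.restrict (Set.Ioi (0:ℝ))) →
      (∀ a ∈ Set.Ioi (0:ℝ), 0 ≤ k a ∧ k a ≤ 1) →
      IntegrableOn (fun a => f a * k a) (Set.Ioi (0:ℝ)) := by
    intro f k hf hk hb
    refine Integrable.mul_bdd (c := 1) hf hk.aestronglyMeasurable ?_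
    filter_upwards [ae_restrict_mem measurableSet_Ioi] with a ha
    rw [Real.norm_eq_abs, abs_of_nonneg (hb a ha).1]
    exact (hb a ha).2
  have hsb : ∀ a ∈ Set.Ioi (0:ℝ), 0 ≤ sig a ∧ sig a ≤ 1 := fun a ha => hrange a (le_of_lt ha)
  have hEm : ∀ x : ℝ, AEMeasurable (fun a => Real.exp (-x * φ a))
      (volume.restrict (Set.Ioi (0:ℝ))) := fun x =>
    Real.measurable_exp.comp_aemeasurable (hφae.const_mul _)
  have hEb : ∀ x : ℝ, 0 ≤ x → ∀ a ∈ Set.Ioi (0:ℝ),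
      0 ≤ Real.exp (-x * φ a) ∧ Real.exp (-x * φ a) ≤ 1 := by
    intro x hx a ha
    refine ⟨(Real.exp_pos _).le, Real.exp_le_one_iff.2 ?_⟩
    have := mul_nonneg hx (hφ0 a ha)
    linarith
  have hgsi := bdd g sig hg hsm.aemeasurable hsb
  have hD : ∀ x : ℝ, 0 < x →
      0 < ∫ a in Set.Ioi (0:ℝ), g a * sig a * Real.exp (-x * φ a) := by
    intro x hx
    have hnn : ∀ a ∈ Set.Ioi (0:ℝ), 0 ≤ g a * sig a * Real.exp (-x * φ a) := fun a ha =>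
      mul_nonneg (mul_nonneg (hg0 a) (hsb a ha).1) (Real.exp_pos _).le
    have hae : 0 ≤ᵐ[volume.restrict (Set.Ioi (0:ℝ))]
        fun a => g a * sig a * Real.exp (-x * φ a) := by
      filter_upwards [ae_restrict_mem measurableSet_Ioi] with a ha using hnn a ha
    refine lt_of_le_of_ne (integral_nonneg_of_ae hae) fun h0 => ?_
    have hz := (integral_eq_zero_iff_of_nonneg_ae hae
      (bdd _ _ hgsi (hEm x) (hEb x hx.le))).1 h0.symm
    have : ∫ a in Set.Ioi (0:ℝ), g a * sig a = 0 := by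
      apply integral_eq_zero_of_ae
      filter_upwards [hz] with a ha
      simpa [Real.exp_ne_zero] using ha
    linarith
  have key : ∀ x y : ℝ, 0 < x → x ≤ y →
      (∫ a in Set.Ioi (0:ℝ), g a * Real.exp (-x * φ a))
        / (∫ a in Set.Ioi (0:ℝ), g a * sig a * Real.exp (-x * φ a))
      ≤ (∫ a in Set.Ioi (0:ℝ), g a * Real.exp (-y * φ a))
        / (∫ a in Set.Ioi (0:ℝ), g a * sig a * Real.exp (-y * φ a)) := by
    intro x y hx hxy
    have hd : 0 ≤ y - x := by linarith
    rw [div_le_div_iff₀ (hD x hx) (hD y (hx.trans_le hxy))]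
    have hw := bdd _ _ hg (hEm x) (hEb x hx.le)
    have hwf := bdd _ _ hw hsm.aemeasurable hsb
    have C := cheb_aux (Set.Ioi 0) measurableSet_Ioi (fun a => g a * Real.exp (-x * φ a)) sig
      (fun a => Real.exp (-(y - x) * φ a))
      (fun a _ => mul_nonneg (hg0 a) (Real.exp_pos _).le) hw hwf
      (bdd _ _ hw (hEm _) (hEb _ hd)) (bdd _ _ hwf (hEm _) (hEb _ hd)) ?_
    · have e : ∀ a, Real.exp (-y * φ a) = Real.exp (-x * φ a) * Real.exp (-(y - x) * φ a) := by
        intro a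
        rw [← Real.exp_add]
        ring_nf
      have e1 : (fun a => g a * sig a * Real.exp (-y * φ a))
          = fun a => g a * Real.exp (-x * φ a) * sig a * Real.exp (-(y - x) * φ a) := by
        funext a; rw [e, ← mul_assoc, mul_right_comm (g a)]
      have e2 : (fun a => g a * Real.exp (-y * φ a))
          = fun a => g a * Real.exp (-x * φ a) * Real.exp (-(y - x) * φ a) := by
        funext a; rw [e, ← mul_assoc]
      have e3 : (fun a => g a * sig a * Real.exp (-x * φ a))
          = fun a => g a * Real.exp (-x * φ a) * sig a := by
        funext a; rw [mul_right_comm]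
      rw [e1, e2, e3]
      exact C
    · have main : ∀ a ∈ Set.Ioi (0:ℝ), ∀ b ∈ Set.Ioi (0:ℝ), a ≤ b →
          0 ≤ sig b - sig a ∧ 0 ≤ Real.exp (-(y - x) * φ a) - Real.exp (-(y - x) * φ b) := by
        intro a ha b hb hab
        refine ⟨sub_nonneg.2 (hmono (Set.Ioi_subset_Ici_self ha) (Set.Ioi_subset_Ici_self hb) hab),
          sub_nonneg.2 (Real.exp_le_exp.2 ?_)⟩
        have := mul_le_mul_of_nonneg_left (hφm ha hb hab) hd
        linarith
      intro a ha b hb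
      rcases le_total a b with hab | hab
      · obtain ⟨p, q⟩ := main a ha b hb hab
        nlinarith [mul_nonneg p q]
      · obtain ⟨p, q⟩ := main b hb a ha hab
        nlinarith [mul_nonneg p q]
  have hF : ∀ x, endemicFun sig g c x = c * x +
      (∫ a in Set.Ioi (0:ℝ), g a * Real.exp (-x * φ a))
        / (∫ a in Set.Ioi (0:ℝ), g a * sig a * Real.exp (-x * φ a)) := by
    intro x
    simp only [hφ, endemicFun]
  refine ⟨fun x hx y hy hxy => ?_, fun hc' x hx y hy hxy => ?_⟩
  · rw [hF, hF]
    exact add_le_add (mul_le_mul_of_nonneg_left hxy hc) (key x y hx hxy)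
  · rw [hF, hF]
    exact add_lt_add_of_lt_of_le (mul_lt_mul_of_pos_left hxy hc') (key x y hx hxy.le)
end

section
/- Let (Ω, 𝒫) be a probability space and let T_V, T_R : Ω → [0,∞) be independent random variables with E[T_V] < ∞ and E[T_R] < ∞, satisfying P(T_V > T_R) > 0 and E[min(T_V, T_R)] > 0, and let c ≥ 0. With the step susceptibility σ(a) = 1_{a ≥ T_R} and φ(a) = ∫₀ᵃ σ(u) du = max(a − T_R, 0), the endemic function F(x) = c·x + E[∫₀^{T_V} e^{−xφ(a)} da] / E[∫₀^{T_V} σ(a) e^{−xφ(a)} da] satisfies, for every x > 0, F(x) = c·x + 1 + E[min(T_V, T_R)] / E[∫₀^{max(T_V − T_R, 0)} e^{−xa} da], and F is strictly increasing on (0,∞). -/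
open MeasureTheory ProbabilityTheory

/-- The endemic function in the SIRS (step-susceptibility) case: with `σ(a) = 1_{a ≥ T_R}` and
`φ(a) = max(a − T_R, 0)`,
`F(x) = c·x + E[∫₀^{T_V} e^{−xφ(a)} da] / E[∫₀^{T_V} σ(a) e^{−xφ(a)} da]`. -/
noncomputable def endemicFunSIRS {Ω : Type*} [MeasurableSpace Ω] (μ : Measure Ω)
    (TV TR : Ω → ℝ) (c x : ℝ) : ℝ :=
  c * x +
    (∫ ω, (∫ a in (0:ℝ)..(TV ω), Real.exp (-x * max (a - TR ω) 0)) ∂μ)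
      / (∫ ω, (∫ a in (0:ℝ)..(TV ω),
            (if TR ω ≤ a then (1:ℝ) else 0) * Real.exp (-x * max (a - TR ω) 0)) ∂μ)

lemma sirs_congr_Ioo {f g : ℝ → ℝ} {a b : ℝ} (hab : a ≤ b)
    (h : ∀ t, a < t → t < b → f t = g t) : ∫ t in a..b, f t = ∫ t in a..b, g t := by
  apply intervalIntegral.integral_congr_ae
  have : ∀ᵐ t : ℝ, t ≠ b := by
    simp [ae_iff]
  filter_upwards [this] with t ht hm
  rw [Set.uIoc_of_le hab] at hm
  exact h t hm.1 (lt_of_le_of_ne hm.2 ht)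

lemma sirs_shift (x v r : ℝ) (h : r ≤ v) :
    ∫ a in r..v, Real.exp (-x * max (a - r) 0) = ∫ a in (0:ℝ)..(v - r), Real.exp (-x * a) := by
  rw [sirs_congr_Ioo (g := fun a => Real.exp (-x * (a - r))) h]
  · rw [intervalIntegral.integral_comp_sub_right (fun a => Real.exp (-x * a))]
    simp
  · intro t h1 h2
    rw [max_eq_left (by linarith)]

lemma sirs_num (x v r : ℝ) (hv : 0 ≤ v) (hr : 0 ≤ r) :
    ∫ a in (0:ℝ)..v, Real.exp (-x * max (a - r) 0)
      = min v r + ∫ a in (0:ℝ)..(max (v - r) 0), Real.exp (-x * a) := by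
  have key : ∀ w, 0 ≤ w → w ≤ r → ∫ a in (0:ℝ)..w, Real.exp (-x * max (a - r) 0) = w := by
    intro w hw hwr
    rw [sirs_congr_Ioo (g := fun _ => (1:ℝ)) hw]
    · simp
    · intro t h1 h2
      rw [max_eq_right (by linarith)]
      simp
  rcases le_total v r with h | h
  · rw [min_eq_left h, max_eq_right (by linarith), key v hv h]
    simp
  · rw [min_eq_right h, max_eq_left (by linarith), ← sirs_shift x v r h]
    have hc : Continuous fun a : ℝ => Real.exp (-x * max (a - r) 0) := by fun_prop
    rw [← intervalIntegral.integral_add_adjacent_intervals (hc.intervalIntegrable 0 r)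
      (hc.intervalIntegrable r v), key r hr le_rfl]

lemma sirs_den (x v r : ℝ) (hv : 0 ≤ v) (hr : 0 ≤ r) :
    ∫ a in (0:ℝ)..v, (if r ≤ a then (1:ℝ) else 0) * Real.exp (-x * max (a - r) 0)
      = ∫ a in (0:ℝ)..(max (v - r) 0), Real.exp (-x * a) := by
  have key : ∀ w, 0 ≤ w → w ≤ r →
      ∫ a in (0:ℝ)..w, (if r ≤ a then (1:ℝ) else 0) * Real.exp (-x * max (a - r) 0) = 0 := by
    intro w hw hwr
    rw [sirs_congr_Ioo (g := fun _ => (0:ℝ)) hw]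
    · simp
    · intro t h1 h2
      rw [if_neg (by linarith)]
      simp
  rcases le_total v r with h | h
  · rw [max_eq_right (by linarith), key v hv h]
    simp
  · rw [max_eq_left (by linarith), ← sirs_shift x v r h]
    have hc : Continuous fun a : ℝ => Real.exp (-x * max (a - r) 0) := by fun_prop
    have hi : ∀ s t : ℝ, IntervalIntegrable (fun a : ℝ =>
        (if r ≤ a then (1:ℝ) else 0) * Real.exp (-x * max (a - r) 0)) volume s t := by
      intro s t
      have h0 := hc.intervalIntegrable (μ := volume) s t
      refine h0.mono_fun ?_ ?_
      · refine Measurable.aestronglyMeasurable ?_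
        refine Measurable.mul ?_ hc.measurable
        exact Measurable.ite measurableSet_Ici measurable_const measurable_const
      · refine Filter.Eventually.of_forall fun a => ?_
        dsimp only
        split_ifs <;> simp [Real.exp_nonneg]
    rw [← intervalIntegral.integral_add_adjacent_intervals (hi 0 r) (hi r v), key r hr le_rfl,
      zero_add]
    apply sirs_congr_Ioo h
    intro t h1 h2
    rw [if_pos h1.le, one_mul]

lemma sirs_G_lt (x y w : ℝ) (hxy : x < y) (hw : 0 < w) :
    ∫ a in (0:ℝ)..w, Real.exp (-y * a) < ∫ a in (0:ℝ)..w, Real.exp (-x * a) := by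
  apply intervalIntegral.integral_lt_integral_of_continuousOn_of_le_of_exists_lt hw
  · fun_prop
  · fun_prop
  · intro t ht
    apply Real.exp_le_exp.2
    nlinarith [ht.1]
  · refine ⟨w, ⟨hw.le, le_rfl⟩, ?_⟩
    apply Real.exp_lt_exp.2
    nlinarith

/-- For independent nonnegative integrable `T_V, T_R` with `P(T_V > T_R) > 0`
and `E[min(T_V,T_R)] > 0`, and `c ≥ 0`, the SIRS endemic function satisfies, for every `x > 0`,
`F(x) = c·x + 1 + E[min(T_V,T_R)] / E[∫₀^{max(T_V−T_R,0)} e^{−xa} da]`, and `F` is strictly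
increasing on `(0,∞)`. -/
theorem endemicFunSIRS_formula_and_strictMono {Ω : Type*} [MeasurableSpace Ω]
    (μ : Measure Ω) [IsProbabilityMeasure μ]
    (TV TR : Ω → ℝ) (hTV0 : ∀ ω, 0 ≤ TV ω) (hTR0 : ∀ ω, 0 ≤ TR ω)
    (hTVint : Integrable TV μ) (hTRint : Integrable TR μ)
    (hindep : IndepFun TV TR μ)
    (hP : 0 < μ {ω | TR ω < TV ω})
    (hmin : 0 < ∫ ω, min (TV ω) (TR ω) ∂μ)
    (c : ℝ) (hc : 0 ≤ c) :
    (∀ x : ℝ, 0 < x →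
        endemicFunSIRS μ TV TR c x
          = c * x + 1 + (∫ ω, min (TV ω) (TR ω) ∂μ)
              / (∫ ω, (∫ a in (0:ℝ)..(max (TV ω - TR ω) 0), Real.exp (-x * a)) ∂μ))
    ∧ StrictMonoOn (endemicFunSIRS μ TV TR c) (Set.Ioi (0:ℝ)) := by
  set D : ℝ → Ω → ℝ := fun x ω => ∫ a in (0:ℝ)..(max (TV ω - TR ω) 0), Real.exp (-x * a) with hD
  have hDnn : ∀ x ω, 0 ≤ D x ω := by
    intro x ω
    exact intervalIntegral.integral_nonneg (le_max_right _ _) (fun _ _ => (Real.exp_nonneg _))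
  have hwint : Integrable (fun ω => max (TV ω - TR ω) 0) μ :=
    (hTVint.sub hTRint).pos_part
  have hDint : ∀ x, 0 < x → Integrable (D x) μ := by
    intro x hx
    have hcont : Continuous fun w : ℝ => ∫ a in (0:ℝ)..w, Real.exp (-x * a) :=
      intervalIntegral.continuous_primitive
        (fun a b => (by fun_prop : Continuous fun a : ℝ => Real.exp (-x * a)).intervalIntegrable a b) 0
    refine hwint.mono' (hcont.comp_aestronglyMeasurable hwint.aestronglyMeasurable) ?_
    refine Filter.Eventually.of_forall fun ω => ?_
    rw [Real.norm_of_nonneg (hDnn x ω)]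
    have h0 : (0:ℝ) ≤ max (TV ω - TR ω) 0 := le_max_right _ _
    have := intervalIntegral.integral_mono_on (μ := volume) (f := fun a : ℝ => Real.exp (-x * a))
      (g := fun _ => (1:ℝ)) h0 (Continuous.intervalIntegrable (by fun_prop) _ _)
      (Continuous.intervalIntegrable (by fun_prop) _ _)
      (fun t ht => Real.exp_le_one_iff.2 (by nlinarith [ht.1]))
    rw [intervalIntegral.integral_const, sub_zero, smul_eq_mul, mul_one] at this
    exact this
  have hpos : ∀ f : Ω → ℝ, (∀ ω, 0 ≤ f ω) → (∀ ω, TR ω < TV ω → 0 < f ω) → Integrable f μ →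
      0 < ∫ ω, f ω ∂μ := by
    intro f h0 h1 hi
    rw [integral_pos_iff_support_of_nonneg h0 hi]
    exact hP.trans_le (measure_mono fun ω hω => (h1 ω hω).ne')
  have hDlt : ∀ x y ω, x < y → TR ω < TV ω → D y ω < D x ω := by
    intro x y ω hxy h
    exact sirs_G_lt x y _ hxy (lt_max_of_lt_left (by linarith))
  have hDle : ∀ x y ω, x < y → D y ω ≤ D x ω := by
    intro x y ω hxy
    by_cases h : TR ω < TV ω
    · exact (hDlt x y ω hxy h).le
    · have : max (TV ω - TR ω) 0 = 0 := max_eq_right (by linarith)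
      simp [hD, this]
  have hDpos : ∀ x, 0 < x → 0 < ∫ ω, D x ω ∂μ := by
    intro x hx
    exact hpos _ (hDnn x) (fun ω h => (hDnn (x+1) ω).trans_lt (hDlt x (x+1) ω (by linarith) h))
      (hDint x hx)
  have hform : ∀ x : ℝ, 0 < x → endemicFunSIRS μ TV TR c x
          = c * x + 1 + (∫ ω, min (TV ω) (TR ω) ∂μ) / (∫ ω, D x ω ∂μ) := by
    intro x hx
    have hne := (hDpos x hx).ne'
    have e1 : (fun ω => ∫ a in (0:ℝ)..(TV ω), Real.exp (-x * max (a - TR ω) 0))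
        = fun ω => min (TV ω) (TR ω) + D x ω :=
      funext fun ω => sirs_num x _ _ (hTV0 ω) (hTR0 ω)
    have e2 : (fun ω => ∫ a in (0:ℝ)..(TV ω),
            (if TR ω ≤ a then (1:ℝ) else 0) * Real.exp (-x * max (a - TR ω) 0)) = D x :=
      funext fun ω => sirs_den x _ _ (hTV0 ω) (hTR0 ω)
    unfold endemicFunSIRS
    have hm : Integrable (fun ω => min (TV ω) (TR ω)) μ := hTVint.inf hTRint
    rw [e1, e2, integral_add hm (hDint x hx)]
    field_simp
    ring
  refine ⟨hform, ?_⟩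
  intro x hx y hy hxy
  rw [hform x hx, hform y hy]
  have hlt : ∫ ω, D y ω ∂μ < ∫ ω, D x ω ∂μ := by
    have := hpos (fun ω => D x ω - D y ω) (fun ω => sub_nonneg.2 (hDle x y ω hxy))
      (fun ω h => sub_pos.2 (hDlt x y ω hxy h)) ((hDint x hx).sub (hDint y hy))
    rw [integral_sub (hDint x hx) (hDint y hy)] at this
    linarith
  have h1 := div_lt_div_of_pos_left hmin (hDpos y hy) hlt
  have h2 := mul_le_mul_of_nonneg_left hxy.le hc
  linarith
end

section
/- Let (Ω, 𝒫) be a probability space, let σ : Ω × [0,∞) → [0,1] be jointly measurable with a ↦ σ(ω, a) nondecreasing for every ω, let φ(ω, a) = ∫₀ᵃ σ(ω, u) du, and let T_V : Ω → [0,∞) be a random variable independent of σ with 0 < E[T_V] < ∞ and E[φ(·, T_V)] > 0. Then lim_{x → 0⁺} of x·E[∫₀^{T_V} e^{−x φ(·,a)} da] / E[1 − e^{−x φ(·, T_V)}] = E[T_V] / E[φ(·, T_V)]. In particular, the endemic function F_e(x) = x·E[T_I] + x·E[∫₀^{T_V} e^{−xφ(a)} da]/E[1 − e^{−xφ(T_V)}]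 converges as x → 0⁺ to R_c := E[T_V]/E[∫₀^{T_V} σ(a) da]. -/
open MeasureTheory ProbabilityTheory Filter

theorem aux_sm {α : Type*} [MeasurableSpace α] (g : α → ℝ → ℝ)
    (hg : Measurable (Function.uncurry g)) (T : α → ℝ) (hT : Measurable T) :
    Measurable (fun w => ∫ a in (0:ℝ)..(T w), g w a) := by
  have h1 : MeasurableSet {p : α × ℝ | 0 < p.2 ∧ p.2 ≤ T p.1} :=
    (measurableSet_lt measurable_const measurable_snd).inter
      (measurableSet_le measurable_snd (hT.comp measurable_fst))
  have h2 : MeasurableSet {p : α × ℝ | T p.1 < p.2 ∧ p.2 ≤ 0} :=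
    (measurableSet_lt (hT.comp measurable_fst) measurable_snd).inter
      (measurableSet_le measurable_snd measurable_const)
  have k1 := ((hg.indicator h1).stronglyMeasurable.integral_prod_right' (ν := volume)).measurable
  have k2 := ((hg.indicator h2).stronglyMeasurable.integral_prod_right' (ν := volume)).measurable
  convert k1.sub k2 using 1
  funext w
  simp only [intervalIntegral, Pi.sub_apply]
  rw [← integral_indicator measurableSet_Ioc, ← integral_indicator measurableSet_Ioc]
  rfl

theorem aux_aesm {α : Type*} [MeasurableSpace α] {μ : Measure α} (g : α → ℝ → ℝ)
    (hg : Measurable (Function.uncurry g)) (T : α → ℝ) (hT : AEStronglyMeasurable T μ) :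
    AEStronglyMeasurable (fun w => ∫ a in (0:ℝ)..(T w), g w a) μ := by
  refine ⟨_, (aux_sm g hg _ hT.stronglyMeasurable_mk.measurable).stronglyMeasurable, ?_⟩
  filter_upwards [hT.ae_eq_mk] with w hw
  rw [← hw]

theorem aux_slope (c : ℝ) :
    Tendsto (fun x : ℝ => (1 - Real.exp (-x * c)) / x) (nhdsWithin 0 (Set.Ioi 0)) (nhds c) := by
  have h : HasDerivAt (fun x : ℝ => 1 - Real.exp (-x * c)) c 0 := by
    have h1 : HasDerivAt (fun x : ℝ => -x * c) (-1 * c) 0 := (hasDerivAt_id 0).neg.mul_const c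
    have h2 := (h1.exp).const_sub 1
    simpa using h2
  have h3 := (hasDerivAt_iff_tendsto_slope_zero.1 h).mono_left
    (nhdsWithin_mono 0 (fun x (hx : 0 < x) => hx.ne'))
  refine h3.congr (fun x => ?_)
  simp [div_eq_inv_mul]

/-- For a random nondecreasing susceptibility curve `σ : Ω × [0,∞) → [0,1]`
(jointly measurable), `φ(ω,a) = ∫₀ᵃ σ(ω,u) du`, and a random vaccination time `T_V` independent
of `σ` with `0 < E[T_V] < ∞` and `E[φ(·,T_V)] > 0`, one has
`lim_{x→0⁺} x·E[∫₀^{T_V} e^{−xφ(·,a)} da] / E[1 − e^{−xφ(·,T_V)}] = E[T_V]/E[φ(·,T_V)]`;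
in particular the endemic function `F_e(x) = x·E[T_I] + x·E[∫₀^{T_V} e^{−xφ(a)} da]/E[1 − e^{−xφ(T_V)}]`
converges as `x → 0⁺` to the endemic threshold `R_c = E[T_V]/E[∫₀^{T_V} σ(a) da]`. -/
theorem endemic_threshold_limit {Ω : Type*} [MeasurableSpace Ω]
    (μ : Measure Ω) [IsProbabilityMeasure μ]
    (σ : Ω → ℝ → ℝ) (hσmeas : Measurable (Function.uncurry σ))
    (hσmono : ∀ ω, MonotoneOn (σ ω) (Set.Ici (0:ℝ)))
    (hσrange : ∀ ω a, 0 ≤ a → σ ω a ∈ Set.Icc (0:ℝ) 1)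
    (TV : Ω → ℝ) (hTV0 : ∀ ω, 0 ≤ TV ω) (hTVint : Integrable TV μ)
    (hTVmean : 0 < ∫ ω, TV ω ∂μ)
    (hindep : IndepFun TV σ μ)
    (hφpos : 0 < ∫ ω, (∫ u in (0:ℝ)..(TV ω), σ ω u) ∂μ)
    (cTI : ℝ) (hcTI : 0 ≤ cTI) :
    Tendsto (fun x : ℝ =>
        x * (∫ ω, (∫ a in (0:ℝ)..(TV ω), Real.exp (-x * ∫ u in (0:ℝ)..a, σ ω u)) ∂μ)
          / (∫ ω, (1 - Real.exp (-x * ∫ u in (0:ℝ)..(TV ω), σ ω u)) ∂μ))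
      (nhdsWithin 0 (Set.Ioi 0))
      (nhds ((∫ ω, TV ω ∂μ) / (∫ ω, (∫ u in (0:ℝ)..(TV ω), σ ω u) ∂μ)))
    ∧ Tendsto (fun x : ℝ =>
        x * cTI +
          x * (∫ ω, (∫ a in (0:ℝ)..(TV ω), Real.exp (-x * ∫ u in (0:ℝ)..a, σ ω u)) ∂μ)
            / (∫ ω, (1 - Real.exp (-x * ∫ u in (0:ℝ)..(TV ω), σ ω u)) ∂μ))
      (nhdsWithin 0 (Set.Ioi 0))
      (nhds ((∫ ω, TV ω ∂μ) / (∫ ω, (∫ u in (0:ℝ)..(TV ω), σ ω u) ∂μ))) := by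
  set φ : Ω → ℝ → ℝ := fun ω a => ∫ u in (0:ℝ)..a, σ ω u with hφ
  have φmeas : Measurable (Function.uncurry φ) :=
    aux_sm (fun p : Ω × ℝ => σ p.1)
      (hσmeas.comp ((measurable_fst.comp measurable_fst).prodMk measurable_snd))
      Prod.snd measurable_snd
  have φ0 : ∀ ω a, 0 ≤ a → 0 ≤ φ ω a := fun ω a ha =>
    intervalIntegral.integral_nonneg ha (fun u hu => (hσrange ω u hu.1).1)
  have φle : ∀ ω a, 0 ≤ a → φ ω a ≤ a := by
    intro ω a ha
    have := intervalIntegral.norm_integral_le_of_norm_le_const (f := σ ω) (a := 0) (b := a)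
      (C := 1) (fun u hu => by
        rw [Set.uIoc_of_le ha] at hu
        have := hσrange ω u hu.1.le
        rw [Real.norm_eq_abs, abs_of_nonneg this.1]; exact this.2)
    rw [sub_zero, abs_of_nonneg ha, one_mul] at this
    exact (le_abs_self _).trans this
  have gmeas : ∀ x : ℝ, Measurable (Function.uncurry fun ω a => Real.exp (-x * φ ω a)) :=
    fun x => (φmeas.const_mul (-x)).exp
  have φTV : AEStronglyMeasurable (fun ω => φ ω (TV ω)) μ :=
    aux_aesm σ hσmeas TV hTVint.aestronglyMeasurable
  have exple : ∀ x : ℝ, 0 < x → ∀ ω a, 0 ≤ a → ‖Real.exp (-x * φ ω a)‖ ≤ 1 := by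
    intro x hx ω a ha
    rw [Real.norm_eq_abs, abs_of_pos (Real.exp_pos _), Real.exp_le_one_iff]
    have := mul_nonneg hx.le (φ0 ω a ha)
    linarith
  have num : Tendsto (fun x : ℝ => ∫ ω, (∫ a in (0:ℝ)..(TV ω), Real.exp (-x * φ ω a)) ∂μ)
      (nhdsWithin 0 (Set.Ioi 0)) (nhds (∫ ω, TV ω ∂μ)) := by
    refine tendsto_integral_filter_of_dominated_convergence TV ?_ ?_ hTVint ?_
    · exact Eventually.of_forall fun x => aux_aesm _ (gmeas x) TV hTVint.aestronglyMeasurable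
    · filter_upwards [self_mem_nhdsWithin] with x hx
      refine Eventually.of_forall fun ω => ?_
      have := intervalIntegral.norm_integral_le_of_norm_le_const
        (f := fun a => Real.exp (-x * φ ω a)) (a := 0) (b := TV ω)
        (C := 1) (fun u hu => by
          rw [Set.uIoc_of_le (hTV0 ω)] at hu
          exact exple x hx ω u hu.1.le)
      rwa [sub_zero, abs_of_nonneg (hTV0 ω), one_mul] at this
    · refine Eventually.of_forall fun ω => ?_
      have : Tendsto (fun x : ℝ => ∫ a in (0:ℝ)..(TV ω), Real.exp (-x * φ ω a))
          (nhdsWithin 0 (Set.Ioi 0)) (nhds (∫ a in (0:ℝ)..(TV ω), (1:ℝ))) := by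
        refine intervalIntegral.tendsto_integral_filter_of_dominated_convergence
          (fun _ => (1:ℝ)) ?_ ?_ ?_ ?_
        · exact Eventually.of_forall fun x =>
            ((gmeas x).comp measurable_prodMk_left).aestronglyMeasurable
        · filter_upwards [self_mem_nhdsWithin] with x hx
          refine Eventually.of_forall fun a ha => ?_
          rw [Set.uIoc_of_le (hTV0 ω)] at ha
          exact exple x hx ω a ha.1.le
        · exact intervalIntegrable_const
        · refine Eventually.of_forall fun a _ => ?_
          have hc : Continuous fun x : ℝ => Real.exp (-x * φ ω a) := by fun_prop
          have := (hc.tendsto 0).mono_left (nhdsWithin_le_nhds (s := Set.Ioi 0))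
          simpa using this
      simpa using this
  have den : Tendsto (fun x : ℝ => ∫ ω, (1 - Real.exp (-x * φ ω (TV ω))) / x ∂μ)
      (nhdsWithin 0 (Set.Ioi 0)) (nhds (∫ ω, φ ω (TV ω) ∂μ)) := by
    refine tendsto_integral_filter_of_dominated_convergence TV ?_ ?_ hTVint ?_
    · exact Eventually.of_forall fun x =>
        (((φTV.aemeasurable.const_mul (-x)).exp.const_sub 1).div_const x).aestronglyMeasurable
    · filter_upwards [self_mem_nhdsWithin] with x hx
      have hx : 0 < x := hx
      refine Eventually.of_forall fun ω => ?_
      have h1 := Real.add_one_le_exp (-x * φ ω (TV ω))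
      have h2 := (le_abs_self _).trans (exple x hx ω _ (hTV0 ω))
      have h3 := mul_le_mul_of_nonneg_left (φle ω _ (hTV0 ω)) hx.le
      rw [Real.norm_eq_abs, abs_of_nonneg (div_nonneg (by linarith) hx.le), div_le_iff₀ hx]
      linarith
    · exact Eventually.of_forall fun ω => aux_slope _
  have main : Tendsto (fun x : ℝ =>
        x * (∫ ω, (∫ a in (0:ℝ)..(TV ω), Real.exp (-x * φ ω a)) ∂μ)
          / (∫ ω, (1 - Real.exp (-x * φ ω (TV ω))) ∂μ))
      (nhdsWithin 0 (Set.Ioi 0))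
      (nhds ((∫ ω, TV ω ∂μ) / (∫ ω, φ ω (TV ω) ∂μ))) := by
    refine (num.div den hφpos.ne').congr' ?_
    filter_upwards [self_mem_nhdsWithin] with x hx
    rw [Pi.div_apply, integral_div, div_div_eq_mul_div, mul_comm]
  refine ⟨main, ?_⟩
  have hc : Continuous fun x : ℝ => x * cTI := by fun_prop
  have := ((hc.tendsto 0).mono_left (nhdsWithin_le_nhds (s := Set.Ioi 0))).add main
  simpa only [zero_mul, zero_add] using this
end

section
/- Let σ : [0,∞) → [0,1] be a nondecreasing measurable function with φ(a) = ∫₀ᵃ σ(u) du, let g : [0,∞) → [0,∞) be an integrable function with ∫₀^∞ g(a) σ(a) da > 0, and let c > 0. Define for x > 0 the endemic function F_e(x) = c·x + (∫₀^∞ g(a) e^{−xφ(a)} da)/(∫₀^∞ g(a) σ(a) e^{−xφ(a)} da), and set R_c = (∫₀^∞ g(a) da)/(∫₀^∞ g(a) σ(a) da). Then for every R₀ > R_c there exists a unique x > 0 with F_e(x) = R₀, while for R₀ ≤ R_c the equation F_e(x) = R₀ has no solution x > 0. -/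
open MeasureTheory

theorem aux_int (p φ : ℝ → ℝ) (hp : IntegrableOn p (Set.Ioi (0:ℝ)))
    (hφ0 : ∀ a, 0 ≤ a → 0 ≤ φ a) (hφm : MonotoneOn φ (Set.Ici (0:ℝ))) (x : ℝ) (hx : 0 ≤ x) :
    IntegrableOn (fun a => p a * Real.exp (-x * φ a)) (Set.Ioi (0:ℝ)) := by
  have hm : AEMeasurable φ (volume.restrict (Set.Ioi (0:ℝ))) :=
    aemeasurable_restrict_of_monotoneOn measurableSet_Ioi (hφm.mono Set.Ioi_subset_Ici_self)
  refine Integrable.mul_bdd (c := 1) hp ?_ ?_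
  · exact (Real.measurable_exp.comp_aemeasurable (hm.const_mul (-x))).aestronglyMeasurable
  · filter_upwards [ae_restrict_mem measurableSet_Ioi] with a ha
    rw [Real.norm_eq_abs, Real.abs_exp, Real.exp_le_one_iff]
    have := mul_nonneg hx (hφ0 a (le_of_lt ha))
    linarith

theorem aux_cont (p φ : ℝ → ℝ) (hp : IntegrableOn p (Set.Ioi (0:ℝ)))
    (hφ0 : ∀ a, 0 ≤ a → 0 ≤ φ a) (hφm : MonotoneOn φ (Set.Ici (0:ℝ))) :
    ContinuousOn (fun x => ∫ a in Set.Ioi (0:ℝ), p a * Real.exp (-x * φ a)) (Set.Ici 0) := by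
  refine continuousOn_of_dominated (bound := fun a => ‖p a‖) ?_ ?_ hp.norm ?_
  · intro x hx
    exact (aux_int p φ hp hφ0 hφm x hx).aestronglyMeasurable
  · intro x hx
    filter_upwards [ae_restrict_mem measurableSet_Ioi] with a ha
    rw [norm_mul]
    refine mul_le_of_le_one_right (norm_nonneg _) ?_
    rw [Real.norm_eq_abs, Real.abs_exp, Real.exp_le_one_iff]
    have := mul_nonneg (show 0 ≤ x from hx) (hφ0 a (le_of_lt ha))
    linarith
  · filter_upwards with a
    fun_prop

theorem aux_pos (p φ : ℝ → ℝ) (hp : IntegrableOn p (Set.Ioi (0:ℝ)))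
    (hp0 : ∀ a, 0 ≤ a → 0 ≤ p a) (hpos : 0 < ∫ a in Set.Ioi (0:ℝ), p a)
    (hφ0 : ∀ a, 0 ≤ a → 0 ≤ φ a) (hφm : MonotoneOn φ (Set.Ici (0:ℝ))) (x : ℝ) (hx : 0 ≤ x) :
    0 < ∫ a in Set.Ioi (0:ℝ), p a * Real.exp (-x * φ a) := by
  have h0 : 0 ≤ᵐ[volume.restrict (Set.Ioi (0:ℝ))] p := by
    filter_upwards [ae_restrict_mem measurableSet_Ioi] with a ha using hp0 a (le_of_lt ha)
  rw [integral_pos_iff_support_of_nonneg_ae h0 hp] at hpos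
  rw [integral_pos_iff_support_of_nonneg_ae _ (aux_int p φ hp hφ0 hφm x hx)]
  · convert hpos using 2
    ext a
    simp [Real.exp_ne_zero]
  · filter_upwards [h0] with a ha using mul_nonneg ha (Real.exp_pos _).le

/-- Chebyshev's inequality with weight `w`. -/
theorem aux_cheb (sig w h : ℝ → ℝ) (hmono : MonotoneOn sig (Set.Ici (0:ℝ)))
    (hanti : AntitoneOn h (Set.Ici (0:ℝ))) (h0 : ∀ a, 0 ≤ a → 0 ≤ h a)
    (h1 : ∀ a, 0 ≤ a → h a ≤ 1) (hw0 : ∀ a, 0 ≤ w a)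
    (iw : IntegrableOn w (Set.Ioi (0:ℝ)))
    (iws : IntegrableOn (fun a => w a * sig a) (Set.Ioi (0:ℝ)))
    (iwh : IntegrableOn (fun a => w a * h a) (Set.Ioi (0:ℝ)))
    (iwsh : IntegrableOn (fun a => w a * sig a * h a) (Set.Ioi (0:ℝ)))
    (hW : 0 < ∫ a in Set.Ioi (0:ℝ), w a) :
    (∫ a in Set.Ioi (0:ℝ), w a) * (∫ a in Set.Ioi (0:ℝ), w a * sig a * h a)
      ≤ (∫ a in Set.Ioi (0:ℝ), w a * h a) * (∫ a in Set.Ioi (0:ℝ), w a * sig a) := by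
  obtain ⟨m, hm⟩ : ∃ m, m * (∫ a in Set.Ioi (0:ℝ), w a)
      = ∫ a in Set.Ioi (0:ℝ), w a * sig a := ⟨_, div_mul_cancel₀ _ hW.ne'⟩
  obtain ⟨k, hk⟩ : ∃ k, ∀ a, 0 ≤ a → (sig a - m) * (h a - k) ≤ 0 := by
    by_cases hS : ∃ b, 0 ≤ b ∧ sig b ≤ m
    · have hbdd : BddBelow (h '' {b | 0 ≤ b ∧ sig b ≤ m}) := by
        refine ⟨0, ?_⟩
        rintro _ ⟨b, hb, rfl⟩
        exact h0 b hb.1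
      refine ⟨sInf (h '' {b | 0 ≤ b ∧ sig b ≤ m}), fun a ha => ?_⟩
      rcases le_or_gt (sig a) m with hs | hs
      · have := csInf_le hbdd ⟨a, ⟨ha, hs⟩, rfl⟩
        exact mul_nonpos_of_nonpos_of_nonneg (by linarith) (by linarith)
      · have : h a ≤ sInf (h '' {b | 0 ≤ b ∧ sig b ≤ m}) := by
          obtain ⟨b, hb⟩ := hS
          refine le_csInf ⟨_, b, hb, rfl⟩ ?_
          rintro _ ⟨b, hb, rfl⟩
          refine hanti hb.1 ha ?_
          by_contra hab
          have := hmono ha hb.1 (le_of_lt (not_le.mp hab))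
          linarith [hb.2]
        exact mul_nonpos_of_nonneg_of_nonpos (by linarith) (by linarith)
    · push Not at hS
      refine ⟨1, fun a ha => ?_⟩
      have := hS a ha
      have := h1 a ha
      exact mul_nonpos_of_nonneg_of_nonpos (by linarith) (by linarith)
  have key : (∫ a in Set.Ioi (0:ℝ), ((w a * sig a * h a - m * (w a * h a))
      - (k * (w a * sig a) - k * m * w a))) ≤ 0 := by
    refine setIntegral_nonpos measurableSet_Ioi fun a ha => ?_
    have := mul_nonpos_of_nonneg_of_nonpos (hw0 a) (hk a (le_of_lt ha))
    linarith
  have i1 : IntegrableOn (fun a => w a * sig a * h a - m * (w a * h a)) (Set.Ioi (0:ℝ)) :=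
    iwsh.sub (iwh.const_mul m)
  have i2 : IntegrableOn (fun a => k * (w a * sig a) - k * m * w a) (Set.Ioi (0:ℝ)) :=
    (iws.const_mul k).sub (iw.const_mul (k * m))
  rw [integral_sub i1 i2, integral_sub iwsh (iwh.const_mul m), integral_sub (iws.const_mul k) (iw.const_mul (k * m)),
    integral_const_mul, integral_const_mul, integral_const_mul, ← hm] at key
  rw [← hm]
  have : (∫ a in Set.Ioi (0:ℝ), w a * sig a * h a)
      ≤ m * (∫ a in Set.Ioi (0:ℝ), w a * h a) := by linarith
  nlinarith [mul_le_mul_of_nonneg_left this hW.le]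

/-- For a nondecreasing `σ : [0,∞) → [0,1]` (written `sig`), an integrable
nonnegative weight `g` with `∫ g σ > 0`, and `c > 0`, setting
`R_c = (∫₀^∞ g)/(∫₀^∞ g σ)`: for every `R₀ > R_c` the equation `F_e(x) = R₀` has a unique
solution `x > 0`, while for `R₀ ≤ R_c` it has no solution `x > 0`. -/
theorem endemic_equilibrium_existence_uniqueness (sig : ℝ → ℝ) (hsm : Measurable sig)
    (hmono : MonotoneOn sig (Set.Ici (0:ℝ)))
    (hrange : ∀ a, 0 ≤ a → sig a ∈ Set.Icc (0:ℝ) 1)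
    (g : ℝ → ℝ) (hg0 : ∀ a, 0 ≤ g a) (hg : IntegrableOn g (Set.Ioi (0:ℝ)))
    (hgs : 0 < ∫ a in Set.Ioi (0:ℝ), g a * sig a)
    (c : ℝ) (hc : 0 < c) :
    (∀ R₀ : ℝ,
        (∫ a in Set.Ioi (0:ℝ), g a) / (∫ a in Set.Ioi (0:ℝ), g a * sig a) < R₀ →
        ∃! x : ℝ, 0 < x ∧ endemicFun sig g c x = R₀)
    ∧ (∀ R₀ : ℝ,
        R₀ ≤ (∫ a in Set.Ioi (0:ℝ), g a) / (∫ a in Set.Ioi (0:ℝ), g a * sig a) →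
        ∀ x : ℝ, 0 < x → endemicFun sig g c x ≠ R₀) := by
  classical
  set S := Set.Ioi (0:ℝ) with hS
  obtain ⟨φ, hφ⟩ : ∃ φ : ℝ → ℝ, φ = fun a => ∫ u in (0:ℝ)..a, sig u := ⟨_, rfl⟩
  have hii : ∀ a b : ℝ, 0 ≤ a → a ≤ b → IntervalIntegrable sig volume a b := by
    intro a b ha hab
    refine MonotoneOn.intervalIntegrable (hmono.mono ?_)
    rw [Set.uIcc_of_le hab]
    exact fun u hu => ha.trans hu.1
  have hφm : MonotoneOn φ (Set.Ici (0:ℝ)) := by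
    intro a ha b hb hab
    have ha' : (0:ℝ) ≤ a := ha
    have h1 := intervalIntegral.integral_add_adjacent_intervals
      (hii 0 a le_rfl ha') (hii a b ha' hab)
    have h2 : 0 ≤ ∫ u in a..b, sig u :=
      intervalIntegral.integral_nonneg hab fun u hu => (hrange u (ha'.trans hu.1)).1
    simp only [hφ]
    linarith
  have hφ0 : ∀ a, 0 ≤ a → 0 ≤ φ a := by
    intro a ha
    simp only [hφ]
    exact intervalIntegral.integral_nonneg ha fun u hu => (hrange u hu.1).1
  have hgsi : IntegrableOn (fun a => g a * sig a) S := by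
    refine Integrable.mul_bdd (c := 1) hg hsm.aestronglyMeasurable ?_
    filter_upwards [ae_restrict_mem measurableSet_Ioi] with a ha
    have := hrange a (le_of_lt ha)
    rw [Real.norm_eq_abs, abs_of_nonneg this.1]
    exact this.2
  have hgs0 : ∀ a, 0 ≤ a → 0 ≤ g a * sig a := fun a ha => mul_nonneg (hg0 a) (hrange a ha).1
  have hgpos : 0 < ∫ a in S, g a := by
    refine hgs.trans_le (setIntegral_mono_on hgsi hg measurableSet_Ioi fun a ha => ?_)
    exact mul_le_of_le_one_right (hg0 a) (hrange a (le_of_lt ha)).2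
  have hF : ∀ x, endemicFun sig g c x = c * x + (∫ a in S, g a * Real.exp (-x * φ a))
      / (∫ a in S, g a * sig a * Real.exp (-x * φ a)) := by
    intro x
    simp only [endemicFun, hφ, hS]
  have hN := aux_pos g φ hg (fun a _ => hg0 a) hgpos hφ0 hφm
  have hD := aux_pos (fun a => g a * sig a) φ hgsi hgs0 hgs hφ0 hφm
  have hcont : ContinuousOn (endemicFun sig g c) (Set.Ici 0) := by
    have := (aux_cont g φ hg hφ0 hφm).div (aux_cont _ φ hgsi hφ0 hφm) (fun x hx => (hD x hx).ne')
    refine ContinuousOn.congr (f := fun x => c * x + _) ((by fun_prop : Continuous fun x : ℝ => c * x).continuousOn.add this) ?_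
    intro x _
    exact hF x
  have hstrict : StrictMonoOn (endemicFun sig g c) (Set.Ici 0) := by
    intro x hx y hy hxy
    have hx' : (0:ℝ) ≤ x := hx
    have hy' : (0:ℝ) ≤ y := hy
    have hE : ∀ a, Real.exp (-x * φ a) * Real.exp (-(y - x) * φ a) = Real.exp (-y * φ a) := by
      intro a
      rw [← Real.exp_add]
      congr 1
      ring
    have e1 : (fun a => g a * Real.exp (-x * φ a) * sig a)
        = fun a => g a * sig a * Real.exp (-x * φ a) := by
      funext a; ring
    have e2 : (fun a => g a * Real.exp (-x * φ a) * Real.exp (-(y - x) * φ a))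
        = fun a => g a * Real.exp (-y * φ a) := by
      funext a; rw [← hE a]; ring
    have e3 : (fun a => g a * Real.exp (-x * φ a) * sig a * Real.exp (-(y - x) * φ a))
        = fun a => g a * sig a * Real.exp (-y * φ a) := by
      funext a; rw [← hE a]; ring
    have key := aux_cheb sig (fun a => g a * Real.exp (-x * φ a))
      (fun a => Real.exp (-(y - x) * φ a)) hmono
      (by
        intro a ha b hb hab
        apply Real.exp_le_exp.mpr
        have := mul_le_mul_of_nonneg_left (hφm ha hb hab) (sub_nonneg.mpr hxy.le)
        linarith)
      (fun a _ => (Real.exp_pos _).le)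
      (by
        intro a ha
        apply Real.exp_le_one_iff.mpr
        have := mul_nonneg (sub_nonneg.mpr hxy.le) (hφ0 a ha)
        linarith)
      (fun a => mul_nonneg (hg0 a) (Real.exp_pos _).le)
      (aux_int g φ hg hφ0 hφm x hx')
      (by rw [e1]; exact aux_int _ φ hgsi hφ0 hφm x hx')
      (by rw [e2]; exact aux_int g φ hg hφ0 hφm y hy')
      (by rw [e3]; exact aux_int _ φ hgsi hφ0 hφm y hy')
      (hN x hx')
    rw [e1, e2, e3] at key
    rw [hF, hF]
    have h1 := (div_le_div_iff₀ (hD x hx') (hD y hy')).mpr key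
    have h2 := mul_lt_mul_of_pos_left hxy hc
    exact add_lt_add_of_lt_of_le h2 h1
  have hzero : endemicFun sig g c 0 = (∫ a in S, g a) / (∫ a in S, g a * sig a) := by
    rw [hF]; simp
  rw [← hzero]
  constructor
  · intro R hR
    have h0 : 0 ≤ endemicFun sig g c 0 := by
      rw [hzero]; exact (div_pos hgpos hgs).le
    have hRc : 0 ≤ R / c := div_nonneg (h0.trans hR.le) hc.le
    have hbig : R ≤ endemicFun sig g c (R / c) := by
      rw [hF, mul_div_cancel₀ _ hc.ne']
      have := div_pos (hN _ hRc) (hD _ hRc)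
      linarith
    obtain ⟨x, hx, hxR⟩ := intermediate_value_Icc hRc
      (hcont.mono Set.Icc_subset_Ici_self) ⟨hR.le, hbig⟩
    refine ⟨x, ⟨lt_of_le_of_ne hx.1 ?_, hxR⟩, ?_⟩
    · rintro rfl
      exact hR.ne hxR
    · rintro y ⟨hy, hyR⟩
      exact hstrict.injOn (show y ∈ Set.Ici (0:ℝ) from hy.le) hx.1 (hyR.trans hxR.symm)
  · intro R hR x hx h
    have := hstrict (show (0:ℝ) ∈ Set.Ici (0:ℝ) from Set.self_mem_Ici) (show x ∈ Set.Ici (0:ℝ) from hx.le) hx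
    linarith
end
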